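/- Let h be a C^∞ function on a neighborhood W of the origin of ℝ² with h(0,0) = 0 and Dh(0,0) = 0, whose graph z = h(x,y) is invariant for X, in the sense that ∂h/∂x·(y + P(x,y,h(x,y))) + ∂h/∂y·Q(x,y,h(x,y)) = −λ·h(x,y) + R(x,y,h(x,y)) on W. Let V be a C^∞ inverse Jacobi multiplier of X defined on a neighborhood of the origin of ℝ³ which is not flat at the origin and satisfies V(x,y,h(x,y)) = 0 for all (x,y) ∈ W (i.e., the graph of h is contained in the zero set of V). Then there exists a C^∞ function W̃ on a neighborhood of the origin of ℝ³ such that V(x,y,z) = (z − h(x,y))·W̃(x,y,z), the function w(x,y) = W̃(x,y,h(x,y)) is not identically zero on any neighborhood of the origin, and w is an inverse integrating factor of the restricted planar vector field X̄(x,y) = (y + P(x,y,h(x,y)), Q(x,y,h(x,y))), i.e., X̄w = w·div X̄ on a neighborhood of the origin of ℝ². -/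

import Mathlib

/-- Partial derivative of `f : ℝ^k → ℝ` in the `i`-th coordinate direction at `p`. -/
noncomputable def pd {k : ℕ} (f : (Fin k → ℝ) → ℝ) (i : Fin k) (p : Fin k → ℝ) : ℝ :=
  fderiv ℝ f p (Pi.single i 1)

/-- The point `(x, y, h(x,y))` of the graph of `h` over `w = (x,y)`. -/
def emb (h : (Fin 2 → ℝ) → ℝ) (w : Fin 2 → ℝ) : Fin 3 → ℝ := ![w 0, w 1, h w]

open Set Filter Topology MeasureTheory
open scoped ContDiff

theorem contDiff_intervalIntegral_nat {E : Type} [NormedAddCommGroup E] [NormedSpace ℝ E]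
    [ProperSpace E] (n : ℕ) :
    ∀ {F : Type} [NormedAddCommGroup F] [NormedSpace ℝ F] (g : E × ℝ → F),
      ContDiff ℝ n g → ContDiff ℝ n (fun x => ∫ s in (0 : ℝ)..1, g (x, s)) := by
  induction n with
  | zero =>
    intro F _ _ g hg
    simp only [Nat.cast_zero, contDiff_zero] at hg ⊢
    exact intervalIntegral.continuous_parametric_intervalIntegral_of_continuous'
      (f := fun x s => g (x, s)) hg 0 1
  | succ n ih =>
    intro F _ _ g hg
    have hd : Differentiable ℝ g := hg.differentiable (by simp)
    let g' : E × ℝ → E →L[ℝ] F := fun p => (fderiv ℝ g p).comp (ContinuousLinearMap.inl ℝ E ℝ)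
    have hg' : ContDiff ℝ n g' :=
      (hg.fderiv_right (m := n) (by norm_cast)).clm_comp contDiff_const
    have hder : ∀ x s, HasFDerivAt (fun x => g (x, s)) (g' (x, s)) x := fun x s =>
      (hd (x, s)).hasFDerivAt.comp x (hasFDerivAt_prodMk_left x s)
    have hint : ∀ x, HasFDerivAt (fun x => ∫ s in (0 : ℝ)..1, g (x, s))
        (∫ s in (0 : ℝ)..1, g' (x, s)) x := by
      intro x
      obtain ⟨C, hC⟩ := ((isCompact_closedBall x 1).prod (isCompact_Icc (a := (0 : ℝ))
        (b := 1))).exists_bound_of_continuousOn hg'.continuous.continuousOn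
      have hcg := hg.continuous
      have hcg' := hg'.continuous
      refine intervalIntegral.hasFDerivAt_integral_of_dominated_of_fderiv_le
        (F := fun x s => g (x, s)) (F' := fun x s => g' (x, s)) (bound := fun _ => C)
        (Metric.closedBall_mem_nhds x one_pos) (.of_forall fun y => ?_) ?_ ?_ ?_ ?_ ?_
      · exact (by fun_prop : Continuous fun s => g (y, s)).aestronglyMeasurable
      · exact (by fun_prop : Continuous fun s => g (x, s)).intervalIntegrable _ _
      · exact (by fun_prop : Continuous fun s => g' (x, s)).aestronglyMeasurable
      · refine .of_forall fun t ht y hy => hC (y, t) ⟨hy, ?_⟩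
        rw [uIoc_of_le zero_le_one] at ht
        exact Ioc_subset_Icc_self ht
      · exact intervalIntegrable_const
      · exact .of_forall fun t _ y _ => hder y t
    rw [Nat.cast_succ, contDiff_succ_iff_fderiv]
    refine ⟨fun x => (hint x).differentiableAt, by simp, ?_⟩
    rw [funext fun x => (hint x).fderiv]
    exact ih g' hg'

theorem contDiff_intervalIntegral {E F : Type} [NormedAddCommGroup E] [NormedSpace ℝ E]
    [ProperSpace E] [NormedAddCommGroup F] [NormedSpace ℝ F] {g : E × ℝ → F}
    (hg : ContDiff ℝ ∞ g) : ContDiff ℝ ∞ (fun x => ∫ s in (0 : ℝ)..1, g (x, s)) :=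
  contDiff_infty.2 fun n => contDiff_intervalIntegral_nat n g (contDiff_infty.1 hg n)

/-- **Hadamard's lemma** in the first variable. -/
theorem exists_contDiff_eq_add_mul {E : Type} [NormedAddCommGroup E] [NormedSpace ℝ E]
    [ProperSpace E] {G : ℝ × E → ℝ} (hG : ContDiff ℝ ∞ G) :
    ∃ G₁ : ℝ × E → ℝ, ContDiff ℝ ∞ G₁ ∧ ∀ t v, G (t, v) = G (0, v) + t * G₁ (t, v) := by
  have hd : Differentiable ℝ G := hG.differentiable (by simp)
  have hG' : ContDiff ℝ ∞ (fderiv ℝ G) := hG.fderiv_right (by simp)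
  let g : (ℝ × E) × ℝ → ℝ := fun p => fderiv ℝ G (p.2 * p.1.1, p.1.2) (1, 0)
  have hg : ContDiff ℝ ∞ g :=
    (hG'.comp (by fun_prop : ContDiff ℝ ∞ fun p : (ℝ × E) × ℝ => (p.2 * p.1.1, p.1.2))).clm_apply
      contDiff_const
  refine ⟨_, contDiff_intervalIntegral hg, fun t v => ?_⟩
  have hder : ∀ s ∈ uIcc (0 : ℝ) 1, HasDerivAt (fun s => G (s * t, v)) (t * g ((t, v), s)) s := by
    intro s _
    have h1 : HasDerivAt (fun s : ℝ => (s * t, v)) (t, 0) s := by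
      simpa using ((hasDerivAt_id s).mul_const t).prodMk (hasDerivAt_const s v)
    have h2 := (hd (s * t, v)).hasFDerivAt.comp_hasDerivAt s h1
    rwa [show ((t, 0) : ℝ × E) = t • (1, 0) by simp, map_smul] at h2
  have hcg := hg.continuous
  have := intervalIntegral.integral_eq_sub_of_hasDerivAt hder
    ((by fun_prop : Continuous fun s => t * g ((t, v), s)).intervalIntegrable _ _)
  rw [intervalIntegral.integral_const_mul] at this
  rw [this]
  simp

/-- A function smooth on a neighbourhood of a point agrees near it with a globally smooth one. -/
theorem exists_contDiff_eventuallyEq {E : Type*} [NormedAddCommGroup E] [NormedSpace ℝ E]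
    [FiniteDimensional ℝ E] {f : E → ℝ} {U : Set E} {a : E} (hU : IsOpen U) (ha : a ∈ U)
    (hf : ContDiffOn ℝ ∞ f U) : ∃ g : E → ℝ, ContDiff ℝ ∞ g ∧ g =ᶠ[𝓝 a] f := by
  obtain ⟨r, hr, hrU⟩ := Metric.nhds_basis_closedBall.mem_iff.1 (hU.mem_nhds ha)
  let χ : ContDiffBump a := ⟨r / 2, r, by positivity, by linarith⟩
  refine ⟨fun x => χ x * f x, contDiff_iff_contDiffAt.2 fun x => ?_, ?_⟩
  · by_cases hx : x ∈ tsupport χ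
    · rw [χ.tsupport_eq] at hx
      exact χ.contDiffAt.mul (hf.contDiffAt (hU.mem_nhds (hrU hx)))
    · refine (contDiffAt_const (c := (0 : ℝ))).congr_of_eventuallyEq ?_
      filter_upwards [notMem_tsupport_iff_eventuallyEq.1 hx] with y hy
      simp [hy]
  · filter_upwards [χ.eventuallyEq_one] with y hy
    simp [hy]

/-- The order of vanishing of `f` at `0` is at least `N`, expressed through the blow-up of `f`. -/
def VanishesToOrder {E F : Type} [NormedAddCommGroup E] [NormedSpace ℝ E]
    [NormedAddCommGroup F] [NormedSpace ℝ F] (f : E → F) (N : ℕ) : Prop :=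
  ∃ G : ℝ × E → F, ContDiff ℝ ∞ G ∧ ∀ t v, t ≠ 0 → f (t • v) = t ^ N • G (t, v)

theorem hasFDerivAt_snd_of_contDiff {E F : Type} [NormedAddCommGroup E] [NormedSpace ℝ E]
    [NormedAddCommGroup F] [NormedSpace ℝ F] {G : ℝ × E → F} (hG : ContDiff ℝ ∞ G) (t : ℝ)
    (v : E) : HasFDerivAt (fun v => G (t, v))
      ((fderiv ℝ G (t, v)).comp (ContinuousLinearMap.inr ℝ ℝ E)) v :=
  (hG.differentiable (by simp) (t, v)).hasFDerivAt.comp v (hasFDerivAt_prodMk_right t v)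

theorem fderiv_smul_of_blowUp {E F : Type} [NormedAddCommGroup E] [NormedSpace ℝ E]
    [NormedAddCommGroup F] [NormedSpace ℝ F] {f : E → F} (hf : ContDiff ℝ ∞ f) {G : ℝ × E → F}
    (hG : ContDiff ℝ ∞ G) {N : ℕ} {t : ℝ} (ht : t ≠ 0)
    (hfG : ∀ v, f (t • v) = t ^ (N + 1) • G (t, v)) (v : E) :
    fderiv ℝ f (t • v) =
      t ^ N • (fderiv ℝ G (t, v)).comp (ContinuousLinearMap.inr ℝ ℝ E) := by
  have h1 : HasFDerivAt (fun v => f (t • v)) (t • fderiv ℝ f (t • v)) v := by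
    have := (hf.differentiable (by simp) (t • v)).hasFDerivAt.comp v
      ((hasFDerivAt_id v).const_smul t)
    rwa [ContinuousLinearMap.comp_smul, ContinuousLinearMap.comp_id] at this
  have h2 := (hasFDerivAt_snd_of_contDiff hG t v).const_smul (t ^ (N + 1))
  rw [funext hfG] at h1
  have h3 := h1.unique h2
  rw [pow_succ', mul_smul] at h3
  exact smul_right_injective _ ht h3

theorem VanishesToOrder.fderiv {E F : Type} [NormedAddCommGroup E] [NormedSpace ℝ E]
    [NormedAddCommGroup F] [NormedSpace ℝ F] {f : E → F} (hf : ContDiff ℝ ∞ f) {N : ℕ}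
    (h : VanishesToOrder f (N + 1)) : VanishesToOrder (fderiv ℝ f) N := by
  obtain ⟨G, hG, hfG⟩ := h
  exact ⟨_, (hG.fderiv_right (by simp)).clm_comp contDiff_const,
    fun t v ht => fderiv_smul_of_blowUp hf hG ht (fun v => hfG t v ht) v⟩

theorem VanishesToOrder.eq_zero {E F : Type} [NormedAddCommGroup E] [NormedSpace ℝ E]
    [NormedAddCommGroup F] [NormedSpace ℝ F] {f : E → F}
    (h : VanishesToOrder f 1) : f 0 = 0 := by
  obtain ⟨G, hG, hfG⟩ := h
  have hc := hG.continuous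
  have h1 : Tendsto (fun t : ℝ => t ^ 1 • G (t, 0)) (𝓝[≠] 0) (𝓝 0) :=
    ((by fun_prop : Continuous fun t : ℝ => t ^ 1 • G (t, 0)).tendsto' 0 0 (by simp)).mono_left
      nhdsWithin_le_nhds
  refine tendsto_nhds_unique (tendsto_const_nhds.congr' ?_) h1
  filter_upwards [self_mem_nhdsWithin] with t ht
  rw [← hfG t 0 ht, smul_zero]

/-- A smooth function vanishing to all orders along its blow-ups is flat at the origin. -/
theorem iteratedFDeriv_eq_zero_of_vanishesToOrder {E : Type} [NormedAddCommGroup E]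
    [NormedSpace ℝ E] (k : ℕ) : ∀ {F : Type} [NormedAddCommGroup F] [NormedSpace ℝ F] {f : E → F},
      ContDiff ℝ ∞ f → (∀ N, VanishesToOrder f N) → iteratedFDeriv ℝ k f 0 = 0 := by
  induction k with
  | zero =>
    intro F _ _ f hf h
    ext
    simpa using (h 1).eq_zero
  | succ k ih =>
    intro F _ _ f hf h
    rw [← norm_eq_zero, ← norm_iteratedFDeriv_fderiv, norm_eq_zero]
    exact ih (hf.fderiv_right (by simp)) fun N => (h (N + 1)).fderiv hf

/-- The leading homogeneous part at the origin of a smooth function that is not flat. -/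
theorem exists_blowUp_ne_zero {E : Type} [NormedAddCommGroup E] [NormedSpace ℝ E]
    [ProperSpace E] {f : E → ℝ} (hf : ContDiff ℝ ∞ f) (h : ¬ ∀ N, VanishesToOrder f N) :
    ∃ N, ∃ G : ℝ × E → ℝ, ContDiff ℝ ∞ G ∧ (∀ t v, t ≠ 0 → f (t • v) = t ^ N • G (t, v)) ∧
      ∃ v, G (0, v) ≠ 0 := by
  by_contra! hc
  refine h fun N => ?_
  induction N with
  | zero => exact ⟨fun p => f (p.1 • p.2), by fun_prop, by simp⟩
  | succ N ih =>
    obtain ⟨G, hG, hfG⟩ := ih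
    obtain ⟨G₁, hG₁, hGG₁⟩ := exists_contDiff_eq_add_mul hG
    refine ⟨G₁, hG₁, fun t v ht => ?_⟩
    rw [hfG t v ht, hGG₁, hc N G hG hfG v, zero_add, smul_eq_mul, smul_eq_mul, pow_succ, mul_assoc]

theorem tendsto_inv_mul_smul {E : Type*} [NormedAddCommGroup E] [NormedSpace ℝ E] {Φ : E → ℝ}
    {A : E →L[ℝ] ℝ} (hΦ : HasFDerivAt Φ A 0) (h0 : Φ 0 = 0) (v : E) :
    Tendsto (fun t : ℝ => t⁻¹ * Φ (t • v)) (𝓝[≠] 0) (𝓝 (A v)) := by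
  have h1 : HasDerivAt (fun t : ℝ => Φ (t • v)) (A v) 0 := by
    have h2 : HasDerivAt (fun t : ℝ => t • v) v 0 := by
      simpa using (hasDerivAt_id (0 : ℝ)).smul_const v
    exact HasFDerivAt.comp_hasDerivAt (0 : ℝ) (by simpa using hΦ) h2
  have := hasDerivAt_iff_tendsto_slope.1 h1
  refine this.congr fun t => ?_
  simp [slope, h0]

theorem tendsto_smul_nhdsNE_zero {E : Type*} [NormedAddCommGroup E] [NormedSpace ℝ E] (v : E) :
    Tendsto (fun t : ℝ => t • v) (𝓝[≠] 0) (𝓝 0) :=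
  ((by fun_prop : Continuous fun t : ℝ => t • v).tendsto' 0 0 (by simp)).mono_left
    nhdsWithin_le_nhds

/-- The leading part at the origin of a smooth function is homogeneous. -/
theorem blowUp_homogeneous {E : Type} [NormedAddCommGroup E] [NormedSpace ℝ E] {g : E → ℝ}
    {K : ℝ × E → ℝ} (hK : ContDiff ℝ ∞ K) {M : ℕ}
    (hgK : ∀ t v, t ≠ 0 → g (t • v) = t ^ M • K (t, v)) {s : ℝ} (hs : s ≠ 0) (v : E) :
    K (0, s • v) = s ^ M * K (0, v) := by
  have hc := hK.continuous
  have h1 : Tendsto (fun t : ℝ => K (t, s • v)) (𝓝[≠] 0) (𝓝 (K (0, s • v))) :=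
    ((by fun_prop : Continuous fun t : ℝ => K (t, s • v)).tendsto 0).mono_left nhdsWithin_le_nhds
  have h2 : Tendsto (fun t : ℝ => s ^ M * K (t * s, v)) (𝓝[≠] 0) (𝓝 (s ^ M * K (0, v))) :=
    ((by fun_prop : Continuous fun t : ℝ => s ^ M * K (t * s, v)).tendsto' 0 _
      (by simp)).mono_left nhdsWithin_le_nhds
  refine tendsto_nhds_unique (h1.congr' ?_) h2
  filter_upwards [self_mem_nhdsWithin] with t ht
  have h3 := hgK (t * s) v (mul_ne_zero ht hs)
  rw [mul_smul, hgK t _ ht, smul_eq_mul, smul_eq_mul, mul_pow, mul_assoc] at h3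
  exact mul_left_cancel₀ (pow_ne_zero M ht) h3

theorem clm_apply_fin_three (L : (Fin 3 → ℝ) →L[ℝ] ℝ) (w : Fin 3 → ℝ) :
    L w = w 0 * L (Pi.single 0 1) + w 1 * L (Pi.single 1 1) + w 2 * L (Pi.single 2 1) := by
  conv_lhs => rw [← Finset.univ_sum_single w, map_sum, Fin.sum_univ_three]
  have h : ∀ i, (Pi.single i (w i) : Fin 3 → ℝ) = w i • Pi.single i 1 := fun i => by
    rw [← Pi.single_smul', smul_eq_mul, mul_one]
  simp only [h, map_smul, smul_eq_mul]

/-- The leading part `f` at the origin of a solution of the inverse Jacobi multiplier equation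
solves the corresponding equation of the linear part of the vector field. -/
theorem blowUp_linear_equation {lam : ℝ} {P Q R D f : (Fin 3 → ℝ) → ℝ}
    (hP : HasFDerivAt P (0 : (Fin 3 → ℝ) →L[ℝ] ℝ) 0)
    (hQ : HasFDerivAt Q (0 : (Fin 3 → ℝ) →L[ℝ] ℝ) 0)
    (hR : HasFDerivAt R (0 : (Fin 3 → ℝ) →L[ℝ] ℝ) 0)
    (hP0 : P 0 = 0) (hQ0 : Q 0 = 0) (hR0 : R 0 = 0)
    (hD : Tendsto D (𝓝 0) (𝓝 (-lam))) (hf : ContDiff ℝ ∞ f)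
    (hpde : ∀ᶠ p in 𝓝 (0 : Fin 3 → ℝ),
      (p 1 + P p) * pd f 0 p + Q p * pd f 1 p + (-lam * p 2 + R p) * pd f 2 p = f p * D p)
    {F : ℝ × (Fin 3 → ℝ) → ℝ} (hF : ContDiff ℝ ∞ F) {N : ℕ}
    (hfF : ∀ t v, t ≠ 0 → f (t • v) = t ^ (N + 1) • F (t, v)) (v : Fin 3 → ℝ) :
    v 1 * fderiv ℝ F (0, v) (0, Pi.single 0 1) - lam * v 2 * fderiv ℝ F (0, v) (0, Pi.single 2 1)
      = -lam * F (0, v) := by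
  have hpd : ∀ t i, t ≠ 0 → pd f i (t • v) = t ^ N * fderiv ℝ F (t, v) (0, Pi.single i 1) := by
    intro t i ht
    rw [pd, fderiv_smul_of_blowUp hf hF ht (fun v => hfF t v ht) v]
    simp
  have hcF := hF.continuous
  have hcF' : Continuous (fderiv ℝ F) := hF.continuous_fderiv (by simp)
  have hFi : ∀ i : Fin 3, Tendsto (fun t : ℝ => fderiv ℝ F (t, v) (0, Pi.single i 1)) (𝓝[≠] 0)
      (𝓝 (fderiv ℝ F (0, v) (0, Pi.single i 1))) := fun i =>
    ((by fun_prop : Continuous fun t : ℝ => fderiv ℝ F (t, v) (0, Pi.single i 1)).tendsto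
      0).mono_left nhdsWithin_le_nhds
  have hF0 : Tendsto (fun t : ℝ => F (t, v)) (𝓝[≠] 0) (𝓝 (F (0, v))) :=
    ((by fun_prop : Continuous fun t : ℝ => F (t, v)).tendsto 0).mono_left nhdsWithin_le_nhds
  have hl := tendsto_smul_nhdsNE_zero v
  have hlim1 := ((((tendsto_inv_mul_smul hP hP0 v).const_add (v 1)).mul (hFi 0)).add
    ((tendsto_inv_mul_smul hQ hQ0 v).mul (hFi 1))).add
    (((tendsto_inv_mul_smul hR hR0 v).const_add (-lam * v 2)).mul (hFi 2))
  have hlim2 := hF0.mul (hD.comp hl)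
  have heq := tendsto_nhds_unique (hlim1.congr' ?_) hlim2
  · simp only [zero_apply] at heq
    linarith
  · filter_upwards [hl.eventually hpde, self_mem_nhdsWithin] with t ht ht0
    have ht0 : t ≠ 0 := ht0
    rw [hpd t 0 ht0, hpd t 1 ht0, hpd t 2 ht0, hfF t v ht0] at ht
    simp only [Pi.smul_apply, smul_eq_mul] at ht
    refine mul_left_cancel₀ (pow_ne_zero (N + 1) ht0) ?_
    rw [Function.comp_apply, ← mul_assoc, ← ht]
    field_simp
    ring

/-- A homogeneous solution of the linear equation divisible by `z ^ 2` vanishes. -/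
theorem eq_zero_of_linear_equation {lam : ℝ} (hlam : lam ≠ 0) {f k : (Fin 3 → ℝ) → ℝ}
    (hf : Differentiable ℝ f) (hk : Continuous k) {M : ℕ}
    (hhom : ∀ s : ℝ, s ≠ 0 → ∀ v, k (s • v) = s ^ M * k v) (hfk : ∀ v, f v = v 2 ^ 2 * k v)
    (hlin : ∀ v, v 1 * pd f 0 v - lam * v 2 * pd f 2 v = -lam * f v) (v : Fin 3 → ℝ) :
    k v = 0 := by
  have hzero : ∀ v, f v = 0 := by
    intro v
    let γ : ℝ → Fin 3 → ℝ := fun s => ![v 0 + s / lam * v 1, v 1, Real.exp (-s) * v 2]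
    have hγ : ∀ s, HasDerivAt γ ![v 1 / lam, 0, -(Real.exp (-s) * v 2)] s := by
      intro s
      rw [hasDerivAt_pi]
      intro i
      fin_cases i
      · have := (((hasDerivAt_id s).div_const lam).mul_const (v 1)).const_add (v 0)
        simpa [γ, div_eq_inv_mul] using this
      · exact hasDerivAt_const s (v 1)
      · have := ((hasDerivAt_neg s).exp).mul_const (v 2)
        simpa [γ] using this
    have hφ : ∀ s, HasDerivAt (fun s => Real.exp s * f (γ s)) 0 s := by
      intro s
      have h1 := (Real.hasDerivAt_exp s).mul ((hf (γ s)).hasFDerivAt.comp_hasDerivAt s (hγ s))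
      refine h1.congr_deriv ?_
      have h2 := hlin (γ s)
      rw [clm_apply_fin_three]
      have h3 : γ s 1 = v 1 := rfl
      have h4 : γ s 2 = Real.exp (-s) * v 2 := rfl
      rw [h3, h4] at h2
      simp only [pd, Matrix.cons_val, Function.comp_apply] at h2 ⊢
      have h5 : v 1 / lam * fderiv ℝ f (γ s) (Pi.single 0 1)
          - Real.exp (-s) * v 2 * fderiv ℝ f (γ s) (Pi.single 2 1) = -f (γ s) := by
        refine mul_left_cancel₀ hlam ?_
        field_simp
        linear_combination h2
      linear_combination Real.exp s * h5
    have hconst : ∀ s, Real.exp s * f (γ s) = f v := by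
      intro s
      have h1 := is_const_of_deriv_eq_zero (fun s => (hφ s).differentiableAt)
        (fun s => (hφ s).deriv) s 0
      have h2 : γ 0 = v := by
        ext i
        fin_cases i <;> simp [γ]
      rw [h1, h2]
      simp
    have hlim0 : Tendsto (fun s : ℝ => (1 + s)⁻¹) atTop (𝓝 0) :=
      tendsto_inv_atTop_zero.comp (tendsto_atTop_add_const_left _ 1 tendsto_id)
    have hlims : Tendsto (fun s : ℝ => (1 + s)⁻¹ * s) atTop (𝓝 1) := by
      have : Tendsto (fun s : ℝ => 1 - (1 + s)⁻¹) atTop (𝓝 1) := by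
        simpa using hlim0.const_sub 1
      refine this.congr' ?_
      filter_upwards [eventually_gt_atTop 0] with s hs
      field_simp
      ring
    have hexp : Tendsto (fun s : ℝ => Real.exp (-s)) atTop (𝓝 0) :=
      Real.tendsto_exp_neg_atTop_nhds_zero
    have hlimγ : Tendsto (fun s => (1 + s)⁻¹ • γ s) atTop (𝓝 ![v 1 / lam, 0, 0]) := by
      rw [tendsto_pi_nhds]
      intro i
      fin_cases i
      · have := (hlim0.mul_const (v 0)).add (hlims.mul_const (v 1 / lam))
        simp only [zero_mul, zero_add, one_mul] at this
        refine this.congr fun s => ?_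
        simp [γ]
        ring
      · simpa [γ] using hlim0.mul_const (v 1)
      · simpa [γ] using hlim0.mul (hexp.mul_const (v 2))
    have hlimk := (hk.tendsto _).comp hlimγ
    have hpow : Tendsto (fun s : ℝ => Real.exp (-s) * (1 + s) ^ M) atTop (𝓝 0) := by
      have h1 := ((Real.tendsto_pow_mul_exp_neg_atTop_nhds_zero M).comp
        (tendsto_atTop_add_const_left _ (1 : ℝ) tendsto_id)).const_mul (Real.exp 1)
      rw [mul_zero] at h1
      refine h1.congr fun s => ?_
      have : Real.exp (-s) = Real.exp 1 * Real.exp (-(1 + s)) := by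
        rw [← Real.exp_add]
        ring_nf
      simp only [Function.comp_apply, id, this]
      ring
    have hlim := (hpow.mul_const (v 2 ^ 2)).mul hlimk
    simp only [zero_mul] at hlim
    refine tendsto_nhds_unique (tendsto_const_nhds.congr' ?_) hlim
    filter_upwards [eventually_gt_atTop 0] with s hs
    have hs' : (1 + s) ≠ 0 := by positivity
    have h1 : k (γ s) = (1 + s) ^ M * k ((1 + s)⁻¹ • γ s) := by
      rw [← hhom _ hs', smul_inv_smul₀ hs']
    have h2 : Real.exp s * Real.exp (-s) = 1 := by
      rw [← Real.exp_add]
      simp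
    rw [← hconst s, hfk, h1]
    simp only [γ, Matrix.cons_val, Function.comp_apply]
    linear_combination (Real.exp (-s) * v 2 ^ 2 * (1 + s) ^ M *
      k ((1 + s)⁻¹ • ![v 0 + s / lam * v 1, v 1, Real.exp (-s) * v 2])) * h2
  have hk0 : ∀ v : Fin 3 → ℝ, v 2 ≠ 0 → k v = 0 := by
    intro v hv
    have := hfk v
    rw [hzero] at this
    simpa [hv] using this.symm
  by_cases hv : v 2 = 0
  · have h1 : Tendsto (fun ε : ℝ => k (v + ε • Pi.single 2 1)) (𝓝[≠] 0) (𝓝 (k v)) :=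
      ((by fun_prop : Continuous fun ε : ℝ => k (v + ε • Pi.single 2 1)).tendsto' 0 _
        (by simp)).mono_left nhdsWithin_le_nhds
    refine tendsto_nhds_unique h1 (tendsto_const_nhds.congr' ?_)
    filter_upwards [self_mem_nhdsWithin] with ε hε
    exact (hk0 _ (by simpa [hv] using hε)).symm
  · exact hk0 v hv

theorem contDiff_vec_two : ContDiff ℝ ∞ fun p : Fin 3 → ℝ => (![p 0, p 1] : Fin 2 → ℝ) := by
  rw [contDiff_pi]
  intro i
  fin_cases i <;> simp <;> fun_prop

/-- An inverse Jacobi multiplier divisible by the square of `z - η` is flat at the origin. -/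
theorem vanishesToOrder_of_sq_dvd {lam : ℝ} (hlam : lam ≠ 0) {P Q R D f g : (Fin 3 → ℝ) → ℝ}
    {η : (Fin 2 → ℝ) → ℝ}
    (hP : HasFDerivAt P (0 : (Fin 3 → ℝ) →L[ℝ] ℝ) 0)
    (hQ : HasFDerivAt Q (0 : (Fin 3 → ℝ) →L[ℝ] ℝ) 0)
    (hR : HasFDerivAt R (0 : (Fin 3 → ℝ) →L[ℝ] ℝ) 0)
    (hP0 : P 0 = 0) (hQ0 : Q 0 = 0) (hR0 : R 0 = 0)
    (hD : Tendsto D (𝓝 0) (𝓝 (-lam)))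
    (hη : ContDiff ℝ ∞ η) (hη0 : η 0 = 0) (hdη0 : fderiv ℝ η 0 = 0) (hg : ContDiff ℝ ∞ g)
    (hf : ContDiff ℝ ∞ f) (hfg : ∀ p, f p = (p 2 - η ![p 0, p 1]) ^ 2 * g p)
    (hpde : ∀ᶠ p in 𝓝 (0 : Fin 3 → ℝ),
      (p 1 + P p) * pd f 0 p + Q p * pd f 1 p + (-lam * p 2 + R p) * pd f 2 p = f p * D p)
    (N : ℕ) : VanishesToOrder f N := by
  obtain ⟨H, hH, hηH⟩ : ∃ H : ℝ × (Fin 2 → ℝ) → ℝ, ContDiff ℝ ∞ H ∧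
      ∀ t q, η (t • q) = t * H (t, q) := by
    obtain ⟨H, hH, hηH⟩ := exists_contDiff_eq_add_mul
      (hη.comp (contDiff_fst.smul contDiff_snd) : ContDiff ℝ ∞ fun p : ℝ × (Fin 2 → ℝ) =>
        η (p.1 • p.2))
    exact ⟨H, hH, fun t q => by simpa [hη0] using hηH t q⟩
  have hH0 : ∀ q, H (0, q) = 0 := by
    intro q
    have h1 := tendsto_inv_mul_smul (hη.differentiable (by simp) 0).hasFDerivAt hη0 q
    rw [hdη0] at h1
    have hc := hH.continuous
    have h2 : Tendsto (fun t : ℝ => H (t, q)) (𝓝[≠] 0) (𝓝 (H (0, q))) :=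
      ((by fun_prop : Continuous fun t : ℝ => H (t, q)).tendsto 0).mono_left nhdsWithin_le_nhds
    refine tendsto_nhds_unique (h2.congr' ?_) h1
    filter_upwards [self_mem_nhdsWithin] with t ht
    rw [hηH, inv_mul_cancel_left₀ ht]
  let π : (Fin 3 → ℝ) → Fin 2 → ℝ := fun v => ![v 0, v 1]
  have hπ : ContDiff ℝ ∞ π := contDiff_vec_two
  have hu : ContDiff ℝ ∞ fun p : ℝ × (Fin 3 → ℝ) => (p.2 2 - H (p.1, π p.2)) ^ 2 := by
    have := hH.comp (contDiff_fst.prodMk (hπ.comp contDiff_snd) :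
      ContDiff ℝ ∞ fun p : ℝ × (Fin 3 → ℝ) => (p.1, π p.2))
    have h2 : ContDiff ℝ ∞ fun p : ℝ × (Fin 3 → ℝ) => p.2 2 := by fun_prop
    exact (h2.sub this).pow 2
  have hblow : ∀ t v, f (t • v) = t ^ 2 * (v 2 - H (t, π v)) ^ 2 * g (t • v) := by
    intro t v
    have : (![(t • v) 0, (t • v) 1] : Fin 2 → ℝ) = t • π v := by
      ext i
      fin_cases i <;> simp [π]
    rw [hfg, this, hηH]
    simp only [Pi.smul_apply, smul_eq_mul]
    ring
  suffices h : ∀ N, VanishesToOrder g N by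
    obtain ⟨K, hK, hgK⟩ := h N
    refine ⟨fun p => p.1 ^ 2 * (p.2 2 - H (p.1, π p.2)) ^ 2 * K p,
      ((contDiff_fst.pow 2).mul hu).mul hK, fun t v ht => ?_⟩
    rw [hblow, hgK t v ht, smul_eq_mul, smul_eq_mul]
    ring
  by_contra hcon
  obtain ⟨M, K, hK, hgK, v, hv⟩ := exists_blowUp_ne_zero hg hcon
  have hF := hu.mul hK
  have hfF : ∀ t v, t ≠ 0 → f (t • v) = t ^ (M + 1 + 1) •
      (fun p : ℝ × (Fin 3 → ℝ) => (p.2 2 - H (p.1, π p.2)) ^ 2 * K p) (t, v) := by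
    intro t v ht
    rw [hblow, hgK t v ht, smul_eq_mul, smul_eq_mul]
    ring
  have hlin := blowUp_linear_equation hP hQ hR hP0 hQ0 hR0 hD hf hpde hF hfF
  have hcK := hK.continuous
  refine hv (eq_zero_of_linear_equation hlam (k := fun v => K (0, v))
    (f := fun v => (v 2 - H (0, π v)) ^ 2 * K (0, v))
    (fun v => (hasFDerivAt_snd_of_contDiff hF 0 v).differentiableAt) (by fun_prop)
    (fun s hs v => blowUp_homogeneous hK hgK hs v) (fun v => by simp [hH0]) (fun v => ?_) v)
  rw [← hlin v, pd, pd, (hasFDerivAt_snd_of_contDiff hF 0 v).fderiv]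
  simp

theorem hasFDerivAt_emb {h : (Fin 2 → ℝ) → ℝ} {q : Fin 2 → ℝ} (hh : DifferentiableAt ℝ h q) :
    HasFDerivAt (emb h) (ContinuousLinearMap.pi
      ![ContinuousLinearMap.proj 0, ContinuousLinearMap.proj 1, fderiv ℝ h q]) q := by
  rw [hasFDerivAt_pi']
  intro i
  fin_cases i
  · exact (ContinuousLinearMap.proj (R := ℝ) (φ := fun _ : Fin 2 => ℝ) 0).hasFDerivAt
  · exact (ContinuousLinearMap.proj (R := ℝ) (φ := fun _ : Fin 2 => ℝ) 1).hasFDerivAt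
  · exact hh.hasFDerivAt

/-- Chain rule for the restriction of a function to a graph. -/
theorem hasFDerivAt_comp_emb {h : (Fin 2 → ℝ) → ℝ} {q : Fin 2 → ℝ} (hh : DifferentiableAt ℝ h q)
    {F : (Fin 3 → ℝ) → ℝ} (hF : DifferentiableAt ℝ F (emb h q)) :
    DifferentiableAt ℝ (fun v => F (emb h v)) q ∧
      pd (fun v => F (emb h v)) 0 q = pd F 0 (emb h q) + pd h 0 q * pd F 2 (emb h q) ∧
      pd (fun v => F (emb h v)) 1 q = pd F 1 (emb h q) + pd h 1 q * pd F 2 (emb h q) := by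
  have h1 : HasFDerivAt (fun v => F (emb h v)) _ q :=
    hF.hasFDerivAt.comp q (hasFDerivAt_emb hh)
  refine ⟨h1.differentiableAt, ?_, ?_⟩ <;>
  · rw [pd, h1.fderiv, ContinuousLinearMap.comp_apply, clm_apply_fin_three]
    simp [pd]

/-- If `V = (z - h) * Wt` near a point of an invariant graph `z = h`, then the inverse Jacobi
multiplier equation for `V` restricts to the inverse integrating factor equation for `Wt`. -/
theorem restricted_multiplier_equation {lam : ℝ} {P Q R V Wt : (Fin 3 → ℝ) → ℝ}
    {h : (Fin 2 → ℝ) → ℝ} {q : Fin 2 → ℝ} (hh : DifferentiableAt ℝ h q)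
    (hP : ContDiffAt ℝ ∞ P (emb h q)) (hQ : ContDiffAt ℝ ∞ Q (emb h q))
    (hR : ContDiffAt ℝ ∞ R (emb h q)) (hW : ContDiff ℝ ∞ Wt)
    (hinv : pd h 0 q * (q 1 + P (emb h q)) + pd h 1 q * Q (emb h q)
      = -lam * h q + R (emb h q))
    (hmult : ∀ᶠ p in 𝓝 (emb h q),
      (p 1 + P p) * pd V 0 p + Q p * pd V 1 p + (-lam * p 2 + R p) * pd V 2 p
        - V p * (pd P 0 p + pd Q 1 p + (-lam + pd R 2 p)) = 0)
    (hfac : V =ᶠ[𝓝 (emb h q)] fun p => (p 2 - h ![p 0, p 1]) * Wt p) :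
    (q 1 + P (emb h q)) * pd (fun v => Wt (emb h v)) 0 q
        + Q (emb h q) * pd (fun v => Wt (emb h v)) 1 q
      = Wt (emb h q) * (pd (fun v => v 1 + P (emb h v)) 0 q + pd (fun v => Q (emb h v)) 1 q) := by
  have hWd : Differentiable ℝ Wt := hW.differentiable (by simp)
  have hPd := hP.differentiableAt (by simp)
  have hQd := hQ.differentiableAt (by simp)
  have hRd := hR.differentiableAt (by simp)
  let ℓ : ℝ → Fin 3 → ℝ := fun τ => emb h q + τ • Pi.single 2 1
  have hℓ0 : ℓ 0 = emb h q := by simp [ℓ]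
  have hℓc : Tendsto ℓ (𝓝[≠] 0) (𝓝 (emb h q)) :=
    ((by fun_prop : Continuous ℓ).tendsto' 0 _ hℓ0).mono_left nhdsWithin_le_nhds
  have hℓ_zero : ∀ τ, ℓ τ 0 = q 0 := fun τ => by simp [ℓ]; rfl
  have hℓ_one : ∀ τ, ℓ τ 1 = q 1 := fun τ => by simp [ℓ]; rfl
  have hℓ_two : ∀ τ, ℓ τ 2 = h q + τ := fun τ => by simp [ℓ]; rfl
  have hℓπ : ∀ τ, (![ℓ τ 0, ℓ τ 1] : Fin 2 → ℝ) = q := by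
    intro τ
    ext i
    fin_cases i <;> simp [hℓ_zero, hℓ_one]
  have hℓd : HasDerivAt ℓ (Pi.single 2 1) 0 := by
    have := ((hasDerivAt_id (0 : ℝ)).smul_const (Pi.single 2 1 : Fin 3 → ℝ)).const_add (emb h q)
    rwa [one_smul] at this
  have hpdV : ∀ τ, V =ᶠ[𝓝 (ℓ τ)] (fun p => (p 2 - h ![p 0, p 1]) * Wt p) →
      pd V 0 (ℓ τ) = -pd h 0 q * Wt (ℓ τ) + τ * pd Wt 0 (ℓ τ) ∧
      pd V 1 (ℓ τ) = -pd h 1 q * Wt (ℓ τ) + τ * pd Wt 1 (ℓ τ) ∧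
      pd V 2 (ℓ τ) = Wt (ℓ τ) + τ * pd Wt 2 (ℓ τ) := by
    intro τ hτ
    have h1 : HasFDerivAt (fun p : Fin 3 → ℝ => (![p 0, p 1] : Fin 2 → ℝ))
        (ContinuousLinearMap.pi ![ContinuousLinearMap.proj (R := ℝ) (φ := fun _ : Fin 3 => ℝ) 0,
          ContinuousLinearMap.proj 1]) (ℓ τ) := by
      rw [hasFDerivAt_pi']
      intro i
      fin_cases i
      · exact (ContinuousLinearMap.proj (R := ℝ) (φ := fun _ : Fin 3 => ℝ) 0).hasFDerivAt
      · exact (ContinuousLinearMap.proj (R := ℝ) (φ := fun _ : Fin 3 => ℝ) 1).hasFDerivAt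
    have h2 : HasFDerivAt h (fderiv ℝ h q) ![ℓ τ 0, ℓ τ 1] := by
      rw [hℓπ]
      exact hh.hasFDerivAt
    have h3 := (((ContinuousLinearMap.proj (R := ℝ) (φ := fun _ : Fin 3 => ℝ) 2).hasFDerivAt
      (x := ℓ τ)).sub (h2.comp (ℓ τ) h1)).mul (hWd (ℓ τ)).hasFDerivAt
    have h4 := (h3.congr_of_eventuallyEq hτ).fderiv
    have h5 : ∀ e, fderiv ℝ V (ℓ τ) e =
        τ * fderiv ℝ Wt (ℓ τ) e + Wt (ℓ τ) * (e 2 - fderiv ℝ h q ![e 0, e 1]) := by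
      intro e
      have he : (ContinuousLinearMap.pi ![ContinuousLinearMap.proj (R := ℝ)
          (φ := fun _ : Fin 3 => ℝ) 0, ContinuousLinearMap.proj 1]) e = ![e 0, e 1] := by
        ext i
        fin_cases i <;> rfl
      have hz : ℓ τ 2 - h ![ℓ τ 0, ℓ τ 1] = τ := by
        rw [hℓπ, hℓ_two]
        ring
      rw [h4]
      change (ℓ τ 2 - h ![ℓ τ 0, ℓ τ 1]) * fderiv ℝ Wt (ℓ τ) e + Wt (ℓ τ) * (e 2 - fderiv ℝ h q
        ((ContinuousLinearMap.pi ![ContinuousLinearMap.proj (R := ℝ) (φ := fun _ : Fin 3 => ℝ) 0,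
          ContinuousLinearMap.proj 1]) e)) = _
      rw [he, hz]
    have hv0 : (![1, 0] : Fin 2 → ℝ) = Pi.single 0 1 := by
      ext i
      fin_cases i <;> simp
    have hv1 : (![0, 1] : Fin 2 → ℝ) = Pi.single 1 1 := by
      ext i
      fin_cases i <;> simp
    have hv2 : (![0, 0] : Fin 2 → ℝ) = 0 := by
      ext i
      fin_cases i <;> simp
    simp only [pd, h5]
    refine ⟨?_, ?_, ?_⟩
    · simp [hv0]
      ring
    · simp [hv1]
      ring
    · simp [hv2]
      ring
  let S : ℝ → ℝ := fun τ => -lam * (h q + τ) + R (ℓ τ) - pd h 0 q * (q 1 + P (ℓ τ))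
    - pd h 1 q * Q (ℓ τ)
  have hline : ∀ {F : (Fin 3 → ℝ) → ℝ}, DifferentiableAt ℝ F (emb h q) →
      HasDerivAt (fun τ => F (ℓ τ)) (pd F 2 (emb h q)) 0 := by
    intro F hF
    rw [← hℓ0] at hF
    have := hF.hasFDerivAt.comp_hasDerivAt 0 hℓd
    rwa [hℓ0] at this
  have hS : HasDerivAt S (-lam + pd R 2 (emb h q) - pd h 0 q * pd P 2 (emb h q)
      - pd h 1 q * pd Q 2 (emb h q)) 0 := by
    have := (((((hasDerivAt_id (0 : ℝ)).const_add (h q)).const_mul (-lam)).add (hline hRd)).sub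
      (((hline hPd).const_add (q 1)).const_mul (pd h 0 q))).sub
      ((hline hQd).const_mul (pd h 1 q))
    rwa [mul_one] at this
  have hS0 : S 0 = 0 := by
    simp only [S, hℓ0]
    linarith
  have hpdc : ∀ {F : (Fin 3 → ℝ) → ℝ}, ContDiffAt ℝ ∞ F (emb h q) → ∀ i,
      Tendsto (fun τ => pd F i (ℓ τ)) (𝓝[≠] 0) (𝓝 (pd F i (emb h q))) := by
    intro F hF i
    have h1 : ContinuousAt (fderiv ℝ F) (emb h q) :=
      (hF.fderiv_right (m := ∞) (by simp)).continuousAt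
    exact (h1.clm_apply continuousAt_const).tendsto.comp hℓc
  have hPl := (hP.continuousAt.tendsto.comp hℓc).const_add (q 1)
  have hQl := hQ.continuousAt.tendsto.comp hℓc
  have hRl := hR.continuousAt.tendsto.comp hℓc
  have hWl := hW.continuous.continuousAt.tendsto.comp hℓc
  have hidl : Tendsto (fun τ : ℝ => -lam * (h q + τ)) (𝓝[≠] 0) (𝓝 (-lam * h q)) :=
    ((by fun_prop : Continuous fun τ : ℝ => -lam * (h q + τ)).tendsto' 0 _ (by simp)).mono_left
      nhdsWithin_le_nhds
  have hlim1 := hWl.mul (hasDerivAt_iff_tendsto_slope.1 hS)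
  have hlim2 := (((hWl.mul (((hpdc hP 0).add (hpdc hQ 1)).add
    ((hpdc hR 2).const_add (-lam)))).sub (hPl.mul (hpdc hW.contDiffAt 0))).sub
    (hQl.mul (hpdc hW.contDiffAt 1))).sub ((hidl.add hRl).mul (hpdc hW.contDiffAt 2))
  have heq := tendsto_nhds_unique (hlim1.congr' ?_) hlim2
  · obtain ⟨-, hW0, hW1⟩ := hasFDerivAt_comp_emb hh (hWd (emb h q))
    obtain ⟨hPd', hP0, -⟩ := hasFDerivAt_comp_emb hh hPd
    obtain ⟨-, -, hQ1⟩ := hasFDerivAt_comp_emb hh hQd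
    have hP1 : pd (fun v => v 1 + P (emb h v)) 0 q = pd (fun v => P (emb h v)) 0 q := by
      have h1 : HasFDerivAt (fun v => v 1 + P (emb h v)) _ q :=
        ((ContinuousLinearMap.proj (R := ℝ) (φ := fun _ : Fin 2 => ℝ) 1).hasFDerivAt
          (x := q)).add hPd'.hasFDerivAt
      rw [pd, pd, h1.fderiv]
      simp
    rw [hP1, hW0, hW1, hP0, hQ1]
    linear_combination pd Wt 2 (emb h q) * hinv + heq
  · filter_upwards [hℓc.eventually hmult, hℓc.eventually hfac.eventually_nhds,
      self_mem_nhdsWithin] with τ hm hf hτ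
    obtain ⟨h0, h1, h2⟩ := hpdV τ hf
    have hV : V (ℓ τ) = τ * Wt (ℓ τ) := by
      rw [hf.self_of_nhds, hℓπ, hℓ_two]
      ring
    rw [h0, h1, h2, hV, hℓ_one, hℓ_two] at hm
    have hτ0 : τ ≠ 0 := hτ
    refine mul_left_cancel₀ hτ0 ?_
    simp only [slope, hS0, vsub_eq_sub, sub_zero, smul_eq_mul, Function.comp_apply]
    field_simp
    simp only [S]
    linear_combination hm

/-- If a non-flat `C^∞` inverse Jacobi multiplier `V` of `X = (y + P, Q, −λz + R)`
vanishes on an invariant center-manifold graph `z = h(x,y)`, then `V = (z − h)·W̃` for a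
`C^∞` function `W̃`, and `w(x,y) = W̃(x,y,h(x,y))` is a (nontrivial) inverse integrating
factor of the restricted planar vector field `X̄ = (y + P(x,y,h), Q(x,y,h))`. -/
theorem factorization_of_inverseJacobiMultiplier
    (lam : ℝ) (hlam : lam ≠ 0)
    (U : Set (Fin 3 → ℝ)) (hUopen : IsOpen U) (hU0 : (0 : Fin 3 → ℝ) ∈ U)
    (P Q R : (Fin 3 → ℝ) → ℝ)
    (hP : ContDiffOn ℝ (⊤ : ℕ∞) P U) (hQ : ContDiffOn ℝ (⊤ : ℕ∞) Q U) (hR : ContDiffOn ℝ (⊤ : ℕ∞) R U)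
    (hP0 : P 0 = 0) (hdP0 : fderiv ℝ P 0 = 0)
    (hQ0 : Q 0 = 0) (hdQ0 : fderiv ℝ Q 0 = 0)
    (hR0 : R 0 = 0) (hdR0 : fderiv ℝ R 0 = 0)
    -- `h` is `C^∞` on a neighborhood `W` of the origin of `ℝ²`, `h(0,0) = 0`, `Dh(0,0) = 0`
    (W : Set (Fin 2 → ℝ)) (hWopen : IsOpen W) (hW0 : (0 : Fin 2 → ℝ) ∈ W)
    (h : (Fin 2 → ℝ) → ℝ) (hh : ContDiffOn ℝ (⊤ : ℕ∞) h W)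
    (hh0 : h 0 = 0) (hdh0 : fderiv ℝ h 0 = 0)
    -- the graph `z = h(x,y)` is invariant for `X`
    (hinv : ∀ w ∈ W,
      pd h 0 w * (w 1 + P (emb h w)) + pd h 1 w * Q (emb h w)
        = -lam * h w + R (emb h w))
    -- `V` is a `C^∞` inverse Jacobi multiplier of `X` on a neighborhood `U'` of the origin
    (U' : Set (Fin 3 → ℝ)) (hU'open : IsOpen U') (hU'0 : (0 : Fin 3 → ℝ) ∈ U')
    (hU'U : U' ⊆ U)
    (V : (Fin 3 → ℝ) → ℝ) (hV : ContDiffOn ℝ (⊤ : ℕ∞) V U')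
    (hVnz : ∀ O : Set (Fin 3 → ℝ), O ⊆ U' → IsOpen O → O.Nonempty → ∃ p ∈ O, V p ≠ 0)
    (hmult : ∀ p ∈ U',
      (p 1 + P p) * pd V 0 p + Q p * pd V 1 p + (-lam * p 2 + R p) * pd V 2 p
        - V p * (pd P 0 p + pd Q 1 p + (-lam + pd R 2 p)) = 0)
    -- `V` is not flat at the origin
    (hnotflat : ∃ k : ℕ, iteratedFDeriv ℝ k V 0 ≠ 0)
    -- the graph of `h` over `W` lies in the domain of `V` and in the zero set of `V`
    (hgraph : ∀ w ∈ W, emb h w ∈ U')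
    (hVzero : ∀ w ∈ W, V (emb h w) = 0) :
    ∃ U₂ : Set (Fin 3 → ℝ), IsOpen U₂ ∧ (0 : Fin 3 → ℝ) ∈ U₂ ∧ U₂ ⊆ U' ∧
      (∀ p ∈ U₂, (![p 0, p 1] : Fin 2 → ℝ) ∈ W) ∧
      ∃ Wt : (Fin 3 → ℝ) → ℝ, ContDiffOn ℝ (⊤ : ℕ∞) Wt U₂ ∧
        -- the factorization `V(x,y,z) = (z − h(x,y))·W̃(x,y,z)`
        (∀ p ∈ U₂, V p = (p 2 - h ![p 0, p 1]) * Wt p) ∧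
        -- `w(x,y) = W̃(x,y,h(x,y))` is not identically zero near the origin
        (∀ O : Set (Fin 2 → ℝ), IsOpen O → (0 : Fin 2 → ℝ) ∈ O →
          ∃ w ∈ O, Wt (emb h w) ≠ 0) ∧
        -- `w` is an inverse integrating factor of the restricted planar vector field
        ∃ W₂ : Set (Fin 2 → ℝ), IsOpen W₂ ∧ (0 : Fin 2 → ℝ) ∈ W₂ ∧ W₂ ⊆ W ∧
          ∀ w ∈ W₂,
            (w 1 + P (emb h w)) * pd (fun v => Wt (emb h v)) 0 w
              + Q (emb h w) * pd (fun v => Wt (emb h v)) 1 w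
            = Wt (emb h w)
                * (pd (fun v => v 1 + P (emb h v)) 0 w
                    + pd (fun v => Q (emb h v)) 1 w) := by
  obtain ⟨η, hη, hηh⟩ := exists_contDiff_eventuallyEq hWopen hW0 hh
  obtain ⟨Vg, hVg, hVgV⟩ := exists_contDiff_eventuallyEq hU'open hU'0 hV
  have hη0 : η 0 = 0 := hηh.self_of_nhds.trans hh0
  have hdη0 : fderiv ℝ η 0 = 0 := hηh.fderiv_eq.trans hdh0
  let π : (Fin 3 → ℝ) → Fin 2 → ℝ := fun p => ![p 0, p 1]
  have hπ : ContDiff ℝ ∞ π := contDiff_vec_two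
  have hπ0 : Tendsto π (𝓝 0) (𝓝 0) := hπ.continuous.tendsto' 0 0 (by
    ext i
    fin_cases i <;> simp [π])
  have hπemb : ∀ (k : (Fin 2 → ℝ) → ℝ) q, π (emb k q) = q := by
    intro k q
    ext i
    fin_cases i <;> simp [π, emb]
  have hemb : ContDiff ℝ ∞ fun p : ℝ × (Fin 2 → ℝ) =>
      (![p.2 0, p.2 1, p.1 + η p.2] : Fin 3 → ℝ) := by
    rw [contDiff_pi]
    intro i
    fin_cases i <;> simp <;> fun_prop
  obtain ⟨G, hG, hVG⟩ := exists_contDiff_eq_add_mul (hVg.comp hemb)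
  obtain ⟨G₂, hG₂, hGG₂⟩ := exists_contDiff_eq_add_mul hG
  have hsplit : ContDiff ℝ ∞ fun p : Fin 3 → ℝ => (p 2 - η (π p), π p) :=
    (((by fun_prop : ContDiff ℝ ∞ fun p : Fin 3 → ℝ => p 2)).sub (hη.comp hπ)).prodMk hπ
  let Wt : (Fin 3 → ℝ) → ℝ := fun p => G (p 2 - η (π p), π p)
  have hWt : ContDiff ℝ ∞ Wt := hG.comp hsplit
  have hVg_eq : ∀ p, Vg p = Vg (emb η (π p)) + (p 2 - η (π p)) * Wt p := by
    intro p
    have h1 := hVG (p 2 - η (π p)) (π p)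
    have h2 : (![π p 0, π p 1, p 2 - η (π p) + η (π p)] : Fin 3 → ℝ) = p := by
      ext i
      fin_cases i <;> simp [π]
    simp only [Function.comp_apply, h2, zero_add] at h1
    exact h1
  have hemb0 : Tendsto (emb η) (𝓝 0) (𝓝 0) := by
    have hc : Continuous (emb η) := by
      refine continuous_pi fun i => ?_
      have := hη.continuous
      fin_cases i <;> simp [emb] <;> fun_prop
    refine hc.tendsto' 0 0 ?_
    ext i
    fin_cases i <;> simp [emb, hη0]
  have hVgη : ∀ᶠ q in 𝓝 (0 : Fin 2 → ℝ), Vg (emb η q) = 0 := by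
    filter_upwards [hηh, hWopen.mem_nhds hW0, hemb0.eventually hVgV] with q h1 h2 h3
    have : emb η q = emb h q := by simp [emb, h1]
    rw [h3, this, hVzero q h2]
  have hgood : ∀ᶠ p in 𝓝 (0 : Fin 3 → ℝ), p ∈ U' ∧ π p ∈ W ∧
      V p = (p 2 - h (π p)) * Wt p := by
    filter_upwards [hU'open.mem_nhds hU'0, hπ0.eventually (hWopen.mem_nhds hW0),
      hVgV, hπ0.eventually hηh, hπ0.eventually hVgη] with p h1 h2 h3 h4 h5
    refine ⟨h1, h2, ?_⟩
    rw [← h3, hVg_eq p, h5, h4, zero_add]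
  obtain ⟨U₂, hU₂, hU₂open, hU₂0⟩ := mem_nhds_iff.1 hgood
  refine ⟨U₂, hU₂open, hU₂0, fun p hp => (hU₂ hp).1, fun p hp => (hU₂ hp).2.1, Wt,
    hWt.contDiffOn, fun p hp => (hU₂ hp).2.2, ?_, ?_⟩
  · by_contra! hcon
    obtain ⟨O, hO, hO0, hWO⟩ := hcon
    let f : (Fin 3 → ℝ) → ℝ := fun p =>
      (p 2 - η ![p 0, p 1]) ^ 2 * G₂ (p 2 - η (π p), π p)
    have hg : ContDiff ℝ ∞ fun p => G₂ (p 2 - η (π p), π p) := hG₂.comp hsplit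
    have hf : ContDiff ℝ ∞ f := ((contDiff_fst.comp hsplit).pow 2).mul hg
    have hVf : V =ᶠ[𝓝 0] f := by
      filter_upwards [hgood, hπ0.eventually (hO.mem_nhds hO0), hπ0.eventually hηh]
        with p h1 h2 h3
      have h4 := hWO _ h2
      simp only [Wt, hπemb] at h4
      have h5 : emb h (π p) 2 = h (π p) := rfl
      rw [h5, h3, sub_self] at h4
      rw [h1.2.2]
      simp only [Wt, f]
      rw [hGG₂, h4, h3]
      simp only [π]
      ring
    have hPa := hP.contDiffAt (hUopen.mem_nhds hU0)
    have hQa := hQ.contDiffAt (hUopen.mem_nhds hU0)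
    have hRa := hR.contDiffAt (hUopen.mem_nhds hU0)
    have hpdc : ∀ {F : (Fin 3 → ℝ) → ℝ}, ContDiffAt ℝ ∞ F 0 → fderiv ℝ F 0 = 0 → ∀ i,
        Tendsto (pd F i) (𝓝 0) (𝓝 0) := by
      intro F hF hF0 i
      have h1 : ContinuousAt (fderiv ℝ F) 0 :=
        (hF.fderiv_right (m := ∞) (by simp)).continuousAt
      have h2 := (h1.clm_apply (continuousAt_const (y := Pi.single i (1 : ℝ)))).tendsto
      rwa [hF0, zero_apply] at h2
    have hder : ∀ {F : (Fin 3 → ℝ) → ℝ}, ContDiffAt ℝ ∞ F 0 → fderiv ℝ F 0 = 0 →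
        HasFDerivAt F (0 : (Fin 3 → ℝ) →L[ℝ] ℝ) 0 := by
      intro F hF hF0
      rw [← hF0]
      exact (hF.differentiableAt (by simp)).hasFDerivAt
    have hD := ((hpdc hPa hdP0 0).add (hpdc hQa hdQ0 1)).add
      ((hpdc hRa hdR0 2).const_add (-lam))
    simp only [zero_add, add_zero] at hD
    have hflat := vanishesToOrder_of_sq_dvd hlam (hder hPa hdP0) (hder hQa hdQ0) (hder hRa hdR0)
      hP0 hQ0 hR0 hD hη hη0 hdη0 hg hf (fun _ => rfl) (by
        filter_upwards [hVf.eventually_nhds, hU'open.mem_nhds hU'0] with p h1 h2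
        have h3 := hmult p h2
        simp only [pd, Filter.EventuallyEq.fderiv_eq h1, h1.self_of_nhds] at h3 ⊢
        linarith)
    obtain ⟨k, hk⟩ := hnotflat
    refine hk ?_
    rw [(hVf.iteratedFDeriv ℝ k).self_of_nhds]
    exact iteratedFDeriv_eq_zero_of_vanishesToOrder k hf hflat
  · have hW₂ : ∀ᶠ q in 𝓝 (0 : Fin 2 → ℝ), q ∈ W ∧ emb h q ∈ U₂ := by
      filter_upwards [hηh, hWopen.mem_nhds hW0, hemb0.eventually (hU₂open.mem_nhds hU₂0)]
        with q h1 h2 h3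
      have : emb η q = emb h q := by simp [emb, h1]
      exact ⟨h2, this ▸ h3⟩
    obtain ⟨W₂, hW₂, hW₂open, hW₂0⟩ := mem_nhds_iff.1 hW₂
    refine ⟨W₂, hW₂open, hW₂0, fun q hq => (hW₂ hq).1, fun q hq => ?_⟩
    obtain ⟨hqW, hqU⟩ := hW₂ hq
    have hUn := hUopen.mem_nhds (hU'U (hU₂ hqU).1)
    refine restricted_multiplier_equation (V := V)
      ((hh.contDiffAt (hWopen.mem_nhds hqW)).differentiableAt (by simp))
      (hP.contDiffAt hUn) (hQ.contDiffAt hUn) (hR.contDiffAt hUn) hWt (hinv q hqW) ?_ ?_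
    · filter_upwards [hU'open.mem_nhds (hU₂ hqU).1] with p hp using hmult p hp
    · filter_upwards [hU₂open.mem_nhds hqU] with p hp using (hU₂ hp).2.2
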